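/- arXiv:1009.3676 — 2 statements merged into one kernel-verified Lean document; each statement's English description precedes it below -/
import Mathlib

section
/- Let d ≥ 0, n > d, and let T_1 be a subset of {1,…,n} with |T_1| ≤ d, so that the singleton collection {T_1} belongs to L(n,d). Then the poset ideal I_{n,d}({T_1}) is order-isomorphic to L(n − |T_1|, d − |T_1|); explicitly, after fixing a bijection between {1,…,n} ∖ T_1 and {1,…,n − |T_1|}, the map sending S = {S_1,…,S_k} ∈ I_{n,d}({T_1}) to {S_1 ∖ T_1, …, S_k ∖ T_1} is a well-defined order isomorphism (every member of such an S contains T_1). -/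
attribute [local instance] Classical.propDecidable

/-- Collections of subsets of `{1,…,n}` (modelled as `Fin n`). -/
abbrev Coll (n : ℕ) := Finset (Finset (Fin n))

/-- `codim_d X = d + 1 - |X|`. -/
def codim {n : ℕ} (d : ℕ) (X : Finset (Fin n)) : ℤ := (d : ℤ) + 1 - X.card

/-- `ρ_d T = Σ_{X ∈ T} codim_d X`. -/
def rho {n : ℕ} (d : ℕ) (T : Coll n) : ℤ := ∑ X ∈ T, codim d X

/-- `D_d T = codim_d (T_1 ∩ … ∩ T_l) - ρ_d T` (used when `|T| ≥ 2`). -/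
def Dd {n : ℕ} (d : ℕ) (T : Coll n) : ℤ := codim d (T.inf id) - rho d T

/-- Membership in the lattice `L(n,d)`. -/
def memL (n d : ℕ) (T : Coll n) : Prop :=
  (∀ T' ⊆ T, 2 ≤ T'.card → 0 < Dd d T') ∧ ∀ X ∈ T, X.card ≤ d

/-- The intersection lattice `L(n,d)`. -/
structure L (n d : ℕ) where
  val : Coll n
  mem : memL n d val

namespace L

instance (n d : ℕ) : PartialOrder (L n d) where
  le S T := S = T ∨ (rho d S.val < rho d T.val ∧ ∀ X ∈ S.val, ∃ Y ∈ T.val, Y ⊆ X)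
  le_refl S := Or.inl rfl
  le_trans S T U hST hTU := by
    rcases hST with rfl | hST
    · exact hTU
    · rcases hTU with rfl | hTU
      · exact Or.inr hST
      · refine Or.inr ⟨hST.1.trans hTU.1, fun X hX => ?_⟩
        obtain ⟨Y, hY, hYX⟩ := hST.2 X hX
        obtain ⟨Z, hZ, hZY⟩ := hTU.2 Y hY
        exact ⟨Z, hZ, hZY.trans hYX⟩
  le_antisymm S T hST hTS := by
    rcases hST with rfl | hST
    · rfl
    · rcases hTS with rfl | hTS
      · rfl
      · exact absurd (hST.1.trans hTS.1) (lt_irrefl _)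

noncomputable instance (n d : ℕ) : Fintype (L n d) :=
  Fintype.ofInjective (fun T : L n d => T.val)
    (fun a b h => by cases a; cases b; simpa using h)

end L

/-- The minimum element `∅` of `L(n,d)`. -/
def Lbot (n d : ℕ) : L n d :=
  ⟨∅, by
    constructor
    · intro T' hT' h2
      rw [Finset.subset_empty] at hT'
      subst hT'
      simp at h2
    · intro X hX
      simp at hX⟩

/-- The maximum element `{∅}` of `L(n,d)`. -/
def Ltop (n d : ℕ) : L n d :=
  ⟨{∅}, by
    constructor
    · intro T' hT' h2
      have h1 : T'.card ≤ 1 := (Finset.card_le_card hT').trans_eq (Finset.card_singleton _)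
      exact absurd h2 (by omega)
    · intro X hX
      rw [Finset.mem_singleton] at hX
      subst hX
      simp⟩

/-- The singleton collection `{X}` as an element of `L(n,d)`. -/
def singL (n d : ℕ) (X : Finset (Fin n)) (hX : X.card ≤ d) : L n d :=
  ⟨{X}, by
    constructor
    · intro T' hT' h2
      have h1 : T'.card ≤ 1 := (Finset.card_le_card hT').trans_eq (Finset.card_singleton _)
      exact absurd h2 (by omega)
    · intro Y hY
      rw [Finset.mem_singleton] at hY
      subst hY
      exact hX⟩

/-- The type of `T ∈ L(n,d)`: the multiset of codimensions of its members. -/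
def typeOf {n : ℕ} (d : ℕ) (T : L n d) : Multiset ℕ :=
  T.val.val.map (fun X => d + 1 - X.card)

/-- `λ_{n,d}(γ)`: the number of elements of `L(n,d)` of type `γ`. -/
noncomputable def lam (n d : ℕ) (γ : Multiset ℕ) : ℕ :=
  (Finset.univ.filter (fun T : L n d => typeOf d T = γ)).card

/-- `κ_{n,d}(m,T)`: the number of `m`-element sets of `d`-element subsets of `{1,…,n}`
whose corresponding hyperplanes have least upper bound `T` in `L(n,d)`. -/
noncomputable def kappa (n d m : ℕ) (T : L n d) : ℕ :=
  (Finset.univ.filter (fun H : Coll n =>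
      H.card = m ∧ (∀ X ∈ H, X.card = d) ∧
      IsLUB {S : L n d | ∃ X ∈ H, S.val = {X}} T)).card

/-- The subset of `{1,…,n}` obtained from `Y` by pulling back along `e` and adjoining `A`. -/
noncomputable def liftSet {n m : ℕ} (A : Finset (Fin n)) (e : Fin n → Fin m)
    (Y : Finset (Fin m)) : Finset (Fin n) :=
  Finset.univ.filter (fun x => x ∈ A ∨ e x ∈ Y)

section liftSet

variable {n m : ℕ} {A : Finset (Fin n)} {e : Fin n → Fin m}

theorem mem_liftSet {Y : Finset (Fin m)} {x : Fin n} :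
    x ∈ liftSet A e Y ↔ x ∈ A ∨ e x ∈ Y := by
  simp [liftSet]

theorem subset_liftSet (Y : Finset (Fin m)) : A ⊆ liftSet A e Y :=
  fun _ hx => mem_liftSet.2 (Or.inl hx)

theorem liftSet_empty : liftSet A e ∅ = A := by
  ext x; simp [mem_liftSet]

theorem liftSet_inf (T : Coll m) : liftSet A e (T.inf id) = (T.image (liftSet A e)).inf id := by
  ext x
  simp only [mem_liftSet, Finset.mem_inf, Finset.mem_image, id]
  constructor
  · rintro (h | h) _ ⟨Y, hY, rfl⟩
    · exact mem_liftSet.2 (Or.inl h)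
    · exact mem_liftSet.2 (Or.inr (h Y hY))
  · intro h
    by_cases hx : x ∈ A
    · exact Or.inl hx
    · exact Or.inr fun Y hY => (mem_liftSet.1 (h _ ⟨Y, hY, rfl⟩)).resolve_left hx

variable (he : Set.BijOn e ((Aᶜ : Finset (Fin n)) : Set (Fin n)) Set.univ)

include he

theorem image_liftSet_sdiff (Y : Finset (Fin m)) : (liftSet A e Y \ A).image e = Y := by
  ext y
  simp only [Finset.mem_image, Finset.mem_sdiff, mem_liftSet]
  constructor
  · rintro ⟨x, ⟨h | h, hx⟩, rfl⟩
    · exact absurd h hx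
    · exact h
  · intro hy
    obtain ⟨x, hx, rfl⟩ := he.surjOn (Set.mem_univ y)
    exact ⟨x, ⟨Or.inr hy, by simpa using hx⟩, rfl⟩

theorem liftSet_image_sdiff {X : Finset (Fin n)} (hX : A ⊆ X) :
    liftSet A e ((X \ A).image e) = X := by
  ext x
  simp only [mem_liftSet, Finset.mem_image, Finset.mem_sdiff]
  constructor
  · rintro (h | ⟨y, ⟨hy, hyA⟩, hyx⟩)
    · exact hX h
    · by_cases hx : x ∈ A
      · exact hX hx
      · rwa [← he.injOn (by simpa using hyA) (by simpa using hx) hyx]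
  · intro hx
    by_cases hxA : x ∈ A
    · exact Or.inl hxA
    · exact Or.inr ⟨x, ⟨hx, hxA⟩, rfl⟩

theorem liftSet_injective : Function.Injective (liftSet A e) :=
  Function.LeftInverse.injective (g := fun X => (X \ A).image e) (image_liftSet_sdiff he)

theorem liftSet_subset_liftSet {Y Z : Finset (Fin m)} :
    liftSet A e Y ⊆ liftSet A e Z ↔ Y ⊆ Z := by
  constructor
  · intro h
    rw [← image_liftSet_sdiff he Y, ← image_liftSet_sdiff he Z]
    exact Finset.image_subset_image (Finset.sdiff_subset_sdiff h subset_rfl)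
  · intro h x hx
    exact mem_liftSet.2 ((mem_liftSet.1 hx).imp_right (fun hy => h hy))

theorem card_liftSet (Y : Finset (Fin m)) : (liftSet A e Y).card = Y.card + A.card := by
  rw [← Finset.card_sdiff_add_card_eq_card (subset_liftSet (e := e) (A := A) Y)]
  congr 1
  conv_rhs => rw [← image_liftSet_sdiff he Y]
  refine (Finset.card_image_of_injOn (he.injOn.mono fun x hx => ?_)).symm
  have hx' := (Finset.mem_sdiff.1 (Finset.mem_coe.1 hx)).2
  simpa using hx'

variable {d : ℕ} (hA : A.card ≤ d)

include hA

theorem codim_liftSet (Y : Finset (Fin m)) :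
    codim d (liftSet A e Y) = codim (d - A.card) Y := by
  unfold codim
  rw [card_liftSet he]
  push_cast [Nat.cast_sub hA]
  ring

theorem rho_image_liftSet (T : Coll m) :
    rho d (T.image (liftSet A e)) = rho (d - A.card) T := by
  unfold rho
  rw [Finset.sum_image fun _ _ _ _ h => liftSet_injective he h]
  exact Finset.sum_congr rfl fun Y _ => codim_liftSet he hA Y

theorem Dd_image_liftSet (T : Coll m) :
    Dd d (T.image (liftSet A e)) = Dd (d - A.card) T := by
  unfold Dd
  rw [← liftSet_inf, codim_liftSet he hA, rho_image_liftSet he hA]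

theorem memL_image_liftSet (T : Coll m) :
    memL n d (T.image (liftSet A e)) ↔ memL m (d - A.card) T := by
  unfold memL
  refine and_congr ⟨fun h T' hT' h2 => ?_, fun h T' hT' h2 => ?_⟩ ?_
  · rw [← Dd_image_liftSet he hA]
    refine h _ (Finset.image_subset_image hT') ?_
    rwa [Finset.card_image_of_injective _ (liftSet_injective he)]
  · obtain ⟨U, hU, rfl⟩ := Finset.subset_image_iff.1 hT'
    rw [Dd_image_liftSet he hA]
    rw [Finset.card_image_of_injective _ (liftSet_injective he)] at h2
    exact h U hU h2
  · simp only [Finset.forall_mem_image, card_liftSet he]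
    exact forall₂_congr fun Y _ => by omega

end liftSet

theorem L.ext_val {n d : ℕ} {S T : L n d} (h : S.val = T.val) : S = T := by
  cases S; cases T; cases h; rfl

theorem L.le_def {n d : ℕ} {S T : L n d} :
    S ≤ T ↔ S = T ∨ (rho d S.val < rho d T.val ∧ ∀ X ∈ S.val, ∃ Y ∈ T.val, Y ⊆ X) :=
  Iff.rfl

theorem L.le_top {n d : ℕ} (S : L n d) : S ≤ Ltop n d := by
  by_cases hS : S.val = {∅}
  · exact Or.inl (L.ext_val hS)
  refine Or.inr ⟨?_, fun X _ => ⟨∅, Finset.mem_singleton_self _, Finset.empty_subset X⟩⟩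
  have htop : rho d (Ltop n d).val = (d : ℤ) + 1 := by simp [rho, Ltop, codim]
  rw [htop]
  rcases Nat.lt_or_ge S.val.card 2 with h | h
  · rcases Finset.card_le_one_iff_subset_singleton.1 (Nat.le_of_lt_succ h) with ⟨X, hX⟩
    rcases Finset.subset_singleton_iff.1 hX with h0 | h1
    · simp only [rho, h0, Finset.sum_empty]
      omega
    · have hne : X ≠ ∅ := fun h => hS (h1.trans (by rw [h]))
      have hpos : 0 < X.card := Finset.card_pos.2 (Finset.nonempty_iff_ne_empty.2 hne)
      simp only [rho, h1, Finset.sum_singleton, codim]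
      omega
  · have hD := S.mem.1 S.val subset_rfl h
    unfold Dd codim at hD
    omega

theorem subset_of_le_singL {n d : ℕ} {A : Finset (Fin n)} {hA : A.card ≤ d} {S : L n d}
    (h : S ≤ singL n d A hA) {X : Finset (Fin n)} (hX : X ∈ S.val) : A ⊆ X := by
  rcases h with rfl | h
  · rw [Finset.mem_singleton.1 hX]
  · obtain ⟨Y, hY, hYX⟩ := h.2 X hX
    rwa [Finset.mem_singleton.1 hY] at hYX

section liftL

variable {n m d : ℕ} {A : Finset (Fin n)} {e : Fin n → Fin m}
  (he : Set.BijOn e ((Aᶜ : Finset (Fin n)) : Set (Fin n)) Set.univ) (hA : A.card ≤ d)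

/-- The map `L(m, d - |A|) → L(n, d)` adjoining `A` to every member of a collection. -/
noncomputable def liftL (T : L m (d - A.card)) : L n d :=
  ⟨T.val.image (liftSet A e), (memL_image_liftSet he hA T.val).2 T.mem⟩

theorem liftL_le_liftL {S T : L m (d - A.card)} :
    liftL he hA S ≤ liftL he hA T ↔ S ≤ T := by
  rw [L.le_def, L.le_def]
  refine or_congr ⟨fun h => L.ext_val ?_, fun h => by rw [h]⟩ (and_congr ?_ ?_)
  · exact Finset.image_injective (liftSet_injective he) (congrArg L.val h)
  · simp only [liftL, rho_image_liftSet he hA]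
  · simp only [liftL, Finset.forall_mem_image, Finset.exists_mem_image,
      liftSet_subset_liftSet he]

theorem liftL_Ltop : liftL he hA (Ltop m (d - A.card)) = singL n d A hA :=
  L.ext_val (by simp [liftL, Ltop, singL, liftSet_empty])

theorem liftL_le_singL (T : L m (d - A.card)) : liftL he hA T ≤ singL n d A hA := by
  rw [← liftL_Ltop he hA, liftL_le_liftL]
  exact L.le_top T

include he in
theorem image_liftSet_image_sdiff {S : L n d} (hS : S ≤ singL n d A hA) :
    (S.val.image fun X => (X \ A).image e).image (liftSet A e) = S.val := by
  rw [Finset.image_image]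
  refine (Finset.image_congr fun X hX => ?_).trans Finset.image_id
  exact liftSet_image_sdiff he (subset_of_le_singL hS hX)

/-- Adjoining `A` identifies `L(m, d - |A|)` with the ideal generated by `{A}`. -/
noncomputable def idealOrderIso :
    {S : L n d // S ≤ singL n d A hA} ≃o L m (d - A.card) where
  toFun S := ⟨S.val.val.image fun X => (X \ A).image e, by
    rw [← memL_image_liftSet he hA, image_liftSet_image_sdiff he hA S.2]
    exact S.val.mem⟩
  invFun T := ⟨liftL he hA T, liftL_le_singL he hA T⟩
  left_inv S := Subtype.ext (L.ext_val (image_liftSet_image_sdiff he hA S.2))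
  right_inv T := L.ext_val <| by
    simp only [liftL, Finset.image_image]
    exact (Finset.image_congr fun Y _ => image_liftSet_sdiff he Y).trans Finset.image_id
  map_rel_iff' {S T} := by
    rw [← liftL_le_liftL he hA, ← Subtype.coe_le_coe]
    exact iff_of_eq (congrArg₂ _ (L.ext_val (image_liftSet_image_sdiff he hA S.2))
      (L.ext_val (image_liftSet_image_sdiff he hA T.2)))

end liftL

/-- For a subset `T₁` of `{1,…,n}` with `|T₁| ≤ d`, the poset ideal
`I_{n,d}({T₁})` is order-isomorphic to `L(n − |T₁|, d − |T₁|)`; explicitly, after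
fixing a bijection `e` between `{1,…,n} ∖ T₁` and `{1,…,n − |T₁|}`, the map sending
`S = {S_1,…,S_k}` to `{S_1 ∖ T₁, …, S_k ∖ T₁}` (transported along `e`) is a
well-defined order isomorphism. -/
theorem ideal_singleton_orderIso (n d : ℕ) (hnd : d < n)
    (T₁ : Finset (Fin n)) (hT₁ : T₁.card ≤ d)
    (e : Fin n → Fin (n - T₁.card))
    (he : Set.BijOn e ((T₁ᶜ : Finset (Fin n)) : Set (Fin n)) Set.univ) :
    ∃ φ : {S : L n d // S ≤ singL n d T₁ hT₁} ≃o L (n - T₁.card) (d - T₁.card),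
      ∀ S : {S : L n d // S ≤ singL n d T₁ hT₁},
        (φ S).val = S.val.val.image (fun Si => (Si \ T₁).image e) := by
  exact ⟨idealOrderIso he hT₁, fun _ => rfl⟩
end

section
/- Let d ≥ 0, n > d, let T ∈ L(n,d), let T_1 ∈ T be one of its members, and set T' = T ∖ {T_1}. Then the map (S, S') ↦ S ∪ S' is an order isomorphism from the direct product I_{n,d}({T_1}) × I_{n,d}(T') (with componentwise order) onto I_{n,d}(T), with inverse S ↦ ({S_i ∈ S : T_1 ⊆ S_i}, {S_i ∈ S : T_1 ⊄ S_i}). -/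
attribute [local instance] Classical.propDecidable

/-- `T ∖ {T₁}` as an element of `L(n,d)`. -/
def eraseL (n d : ℕ) (T : L n d) (X₁ : Finset (Fin n)) : L n d :=
  ⟨T.val.erase X₁, by
    constructor
    · intro T' hT' h2
      exact T.mem.1 T' (hT'.trans (Finset.erase_subset _ _)) h2
    · intro X hX
      exact T.mem.2 X (Finset.mem_of_mem_erase hX)⟩

open Finset

theorem memL.mono {n d : ℕ} {S U : Coll n} (hU : memL n d U) (h : S ⊆ U) : memL n d S :=
  ⟨fun V hV => hU.1 V (hV.trans h), fun X hX => hU.2 X (h hX)⟩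

theorem codim_anti {n : ℕ} (d : ℕ) {X Y : Finset (Fin n)} (h : Y ⊆ X) :
    codim d X ≤ codim d Y := by
  have := card_le_card h
  unfold codim
  omega

theorem memL.rho_lt_codim_inf {n d : ℕ} {V : Coll n} (hV : memL n d V) (h : 2 ≤ V.card) :
    rho d V < codim d (V.inf id) :=
  sub_pos.1 (hV.1 V Subset.rfl h)

theorem memL.rho_le_codim_inf {n d : ℕ} {V : Coll n} (hV : memL n d V) (hne : V.Nonempty) :
    rho d V ≤ codim d (V.inf id) := by
  rcases Nat.lt_or_ge 1 V.card with h | h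
  · exact (hV.rho_lt_codim_inf h).le
  · obtain ⟨X, rfl⟩ := card_eq_one.1 (le_antisymm h hne.card_pos)
    simp [rho]

/-- Two distinct members of an element of `L(n,d)` lie in no common set of size at most `d`. -/
theorem memL.eq_of_subset {n d : ℕ} {T : Coll n} (hT : memL n d T) {Y Z X : Finset (Fin n)}
    (hY : Y ∈ T) (hZ : Z ∈ T) (hX : X.card ≤ d) (hYX : Y ⊆ X) (hZX : Z ⊆ X) : Y = Z := by
  by_contra hne
  have hsub : ({Y, Z} : Coll n) ⊆ T := by
    intro W hW
    rcases mem_insert.1 hW with rfl | hW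
    · exact hY
    · exact (mem_singleton.1 hW) ▸ hZ
  have hD := (hT.mono hsub).rho_lt_codim_inf (card_pair hne).ge
  have hcard := card_le_card (union_subset hYX hZX)
  have hadd := card_union_add_card_inter Y Z
  rw [rho, sum_pair hne, inf_insert, inf_singleton] at hD
  simp only [codim, id, inf_eq_inter] at hD
  omega

theorem memL.rho_le_codim {n d : ℕ} {V : Coll n} (hV : memL n d V) {Y : Finset (Fin n)}
    (hY : Y.card ≤ d) (h : ∀ X ∈ V, Y ⊆ X) : rho d V ≤ codim d Y := by
  rcases V.eq_empty_or_nonempty with rfl | hne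
  · simp only [rho, sum_empty, codim]
    omega
  · exact (hV.rho_le_codim_inf hne).trans (codim_anti d (Finset.le_inf (f := id) h))

theorem memL.eq_singleton_of_rho_eq {n d : ℕ} {V : Coll n} (hV : memL n d V)
    {Y : Finset (Fin n)} (hY : Y.card ≤ d) (h : ∀ X ∈ V, Y ⊆ X) (heq : rho d V = codim d Y) :
    V = {Y} := by
  rcases V.eq_empty_or_nonempty with rfl | hne
  · simp only [rho, sum_empty, codim] at heq
    omega
  rcases Nat.lt_or_ge 1 V.card with hc | hc
  · exact absurd heq
      ((hV.rho_lt_codim_inf hc).trans_le (codim_anti d (Finset.le_inf (f := id) h))).ne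
  · obtain ⟨X, rfl⟩ := card_eq_one.1 (le_antisymm hc hne.card_pos)
    simp only [rho, sum_singleton, codim] at heq
    rw [eq_of_subset_of_card_le (h X (mem_singleton_self X)) (by omega)]

theorem rho_eq_sum_fiber {n : ℕ} (d : ℕ) {S T : Coll n} {f : Finset (Fin n) → Finset (Fin n)}
    (hf : ∀ X ∈ S, f X ∈ T) : rho d S = ∑ Y ∈ T, rho d (S.filter (fun X => f X = Y)) :=
  (sum_fiberwise_of_maps_to hf _).symm

/-- The order on `L(n,d)` is refinement; the condition on `ρ_d` is automatic. -/
theorem L.le_iff_forall_exists_subset {n d : ℕ} {S T : L n d} :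
    S ≤ T ↔ ∀ X ∈ S.val, ∃ Y ∈ T.val, Y ⊆ X := by
  constructor
  · rintro (rfl | h)
    · exact fun X hX => ⟨X, hX, Subset.rfl⟩
    · exact h.2
  · intro h
    choose! f hfT hfX using h
    have hfib : ∀ Y, ∀ X ∈ S.val.filter (fun X => f X = Y), Y ⊆ X := by
      intro Y X hX
      rw [mem_filter] at hX
      exact hX.2 ▸ hfX X hX.1
    have hmem : ∀ Y, memL n d (S.val.filter (fun X => f X = Y)) :=
      fun Y => S.mem.mono (filter_subset _ _)
    have hle : ∀ Y ∈ T.val, rho d (S.val.filter (fun X => f X = Y)) ≤ codim d Y :=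
      fun Y hY => (hmem Y).rho_le_codim (T.mem.2 Y hY) (hfib Y)
    have hsum := rho_eq_sum_fiber d hfT
    by_cases heq : rho d S.val = rho d T.val
    · left
      rw [hsum, rho, sum_eq_sum_iff_of_le hle] at heq
      have hsing : ∀ Y ∈ T.val, S.val.filter (fun X => f X = Y) = {Y} := fun Y hY =>
        (hmem Y).eq_singleton_of_rho_eq (T.mem.2 Y hY) (hfib Y) (heq Y hY)
      have hval : S.val = T.val := by
        ext X
        constructor
        · intro hX
          have : X ∈ S.val.filter (fun X' => f X' = f X) := mem_filter.2 ⟨hX, rfl⟩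
          rw [hsing _ (hfT X hX), mem_singleton] at this
          exact this ▸ hfT X hX
        · intro hX
          have := mem_singleton_self X
          rw [← hsing X hX] at this
          exact (mem_filter.1 this).1
      cases S; cases T; simpa using hval
    · exact Or.inr ⟨lt_of_le_of_ne (hsum.trans_le (sum_le_sum hle)) heq,
        fun X hX => ⟨f X, hfT X hX, hfX X hX⟩⟩

/-- A refinement of an element of `L(n,d)` whose fibers are in `L(n,d)` is in `L(n,d)`. -/
theorem memL_of_fibers {n d : ℕ} {T U : Coll n} (hT : memL n d T)
    {f : Finset (Fin n) → Finset (Fin n)} (hfT : ∀ X ∈ U, f X ∈ T) (hfX : ∀ X ∈ U, f X ⊆ X)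
    (hfib : ∀ Y ∈ T, memL n d (U.filter (fun X => f X = Y))) : memL n d U := by
  refine ⟨fun V hVU hV => ?_, fun X hX => (hfib _ (hfT X hX)).2 X (mem_filter.2 ⟨hX, rfl⟩)⟩
  set J := V.image f with hJ
  have hJT : J ⊆ T := image_subset_iff.2 fun X hX => hfT X (hVU hX)
  have hVmem : ∀ Y ∈ J, memL n d (V.filter (fun X => f X = Y)) := fun Y hY =>
    (hfib Y (hJT hY)).mono (filter_subset_filter _ hVU)
  have hVne : V.Nonempty := card_pos.1 (by omega)
  rcases Nat.lt_or_ge 1 J.card with hJ2 | hJ1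
  · have hrho := rho_eq_sum_fiber d fun X (hX : X ∈ V) => mem_image_of_mem f hX
    have hle : ∀ Y ∈ J, rho d (V.filter (fun X => f X = Y)) ≤
        codim d Y - (((V.filter (fun X => f X = Y)).inf id \ Y).card : ℤ) := by
      intro Y hY
      obtain ⟨X, hX, hXY⟩ := mem_image.1 hY
      have h1 := (hVmem Y hY).rho_le_codim_inf ⟨X, mem_filter.2 ⟨hX, hXY⟩⟩
      have hYA : Y ⊆ (V.filter (fun X => f X = Y)).inf id :=
        Finset.le_inf (f := id) fun Z hZ => by
          rw [mem_filter] at hZ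
          exact hZ.2 ▸ hfX Z (hVU hZ.1)
      have h2 := card_sdiff_add_card_eq_card hYA
      simp only [codim] at h1 ⊢
      omega
    have hsum := sum_le_sum hle
    rw [sum_sub_distrib, ← hrho] at hsum
    have hJD := (hT.mono hJT).rho_lt_codim_inf hJ2
    have hsub : V.inf id \ J.inf id ⊆
        J.biUnion (fun Y => (V.filter (fun X => f X = Y)).inf id \ Y) := by
      intro x hx
      rw [mem_sdiff] at hx
      obtain ⟨hxV, hxJ⟩ := hx
      rw [mem_inf] at hxJ
      push Not at hxJ
      obtain ⟨Y, hY, hxY⟩ := hxJ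
      have hle : V.inf id ≤ (V.filter (fun X => f X = Y)).inf id := inf_mono (filter_subset _ V)
      exact mem_biUnion.2 ⟨Y, hY, mem_sdiff.2 ⟨hle hxV, hxY⟩⟩
    have hcard : ((V.inf id \ J.inf id).card : ℤ) ≤
        ∑ Y ∈ J, (((V.filter (fun X => f X = Y)).inf id \ Y).card : ℤ) := by
      exact_mod_cast (card_le_card hsub).trans card_biUnion_le
    have hdiff := card_le_card_sdiff_add_card (s := V.inf id) (t := J.inf id)
    simp only [Dd, rho, codim] at hsum hJD ⊢
    omega
  · obtain ⟨Y, hY⟩ := card_eq_one.1 (le_antisymm hJ1 (hVne.image f).card_pos)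
    have hfilter : V.filter (fun X => f X = Y) = V :=
      filter_true_of_mem fun X hX => mem_singleton.1 (hY ▸ mem_image_of_mem f hX)
    have := hVmem Y (hY ▸ mem_singleton_self Y)
    rw [hfilter] at this
    exact this.1 V Subset.rfl hV

theorem L.le_singL_iff {n d : ℕ} {S : L n d} {X₁ : Finset (Fin n)} {h : X₁.card ≤ d} :
    S ≤ singL n d X₁ h ↔ ∀ X ∈ S.val, X₁ ⊆ X := by
  simp [L.le_iff_forall_exists_subset, singL]

theorem L.le_eraseL_iff {n d : ℕ} {S T : L n d} {X₁ : Finset (Fin n)} :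
    S ≤ eraseL n d T X₁ ↔ ∀ X ∈ S.val, ∃ Y ∈ T.val, Y ≠ X₁ ∧ Y ⊆ X := by
  rw [L.le_iff_forall_exists_subset]
  simp only [eraseL, mem_erase]
  grind

theorem L.not_subset_of_le_eraseL {n d : ℕ} {S T : L n d} {X₁ : Finset (Fin n)}
    (hX₁ : X₁ ∈ T.val) (hS : S ≤ eraseL n d T X₁) {X : Finset (Fin n)} (hX : X ∈ S.val) :
    ¬ X₁ ⊆ X := by
  intro h
  obtain ⟨Y, hY, hne, hYX⟩ := L.le_eraseL_iff.1 hS X hX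
  exact hne (T.mem.eq_of_subset hY hX₁ (S.mem.2 X hX) hYX h)

theorem memL_union {n d : ℕ} {S S' T : L n d} {X₁ : Finset (Fin n)} (hX₁ : X₁ ∈ T.val)
    (hS : ∀ X ∈ S.val, X₁ ⊆ X) (hS' : S' ≤ eraseL n d T X₁) :
    memL n d (S.val ∪ S'.val) := by
  have hns := fun X => L.not_subset_of_le_eraseL hX₁ hS' (X := X)
  have h := L.le_eraseL_iff.1 hS'
  choose! f hfT hfne hfX using h
  refine memL_of_fibers (f := fun X => if X₁ ⊆ X then X₁ else f X) T.mem ?_ ?_ ?_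
  · intro X hX
    grind
  · intro X hX
    grind
  · intro Y hY
    by_cases hYX : Y = X₁
    · refine S.mem.mono fun X hX => ?_
      grind
    · refine S'.mem.mono fun X hX => ?_
      grind

/-- For `T ∈ L(n,d)`, `T₁ ∈ T` and `T' = T ∖ {T₁}`, the map
`(S, S') ↦ S ∪ S'` is an order isomorphism from `I_{n,d}({T₁}) × I_{n,d}(T')`
(componentwise order) onto `I_{n,d}(T)`, with inverse
`S ↦ ({Sᵢ ∈ S : T₁ ⊆ Sᵢ}, {Sᵢ ∈ S : T₁ ⊄ Sᵢ})`. -/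
theorem ideal_orderIso_ideal_prod_ideal (n d : ℕ) (hnd : d < n)
    (T : L n d) (X₁ : Finset (Fin n)) (hX₁ : X₁ ∈ T.val) :
    ∃ φ : ({S : L n d // S ≤ singL n d X₁ (T.mem.2 X₁ hX₁)}
            × {S : L n d // S ≤ eraseL n d T X₁}) ≃o {S : L n d // S ≤ T},
      (∀ p, (φ p).val.val = p.1.val.val ∪ p.2.val.val) ∧
      (∀ S : {S : L n d // S ≤ T},
        ((φ.symm S).1.val.val = S.val.val.filter (fun Y => X₁ ⊆ Y)) ∧
        ((φ.symm S).2.val.val = S.val.val.filter (fun Y => ¬ X₁ ⊆ Y))) := by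
  have hns := fun {S : L n d} (hS : S ≤ eraseL n d T X₁) {X : Finset (Fin n)} (hX : X ∈ S.val) =>
    L.not_subset_of_le_eraseL hX₁ hS hX
  let union (p : {S : L n d // S ≤ singL n d X₁ (T.mem.2 X₁ hX₁)}
      × {S : L n d // S ≤ eraseL n d T X₁}) : {S : L n d // S ≤ T} :=
    ⟨⟨p.1.val.val ∪ p.2.val.val, memL_union hX₁ (L.le_singL_iff.1 p.1.2) p.2.2⟩, by
      rw [L.le_iff_forall_exists_subset]
      intro X hX
      rcases mem_union.1 hX with hX | hX
      · exact ⟨X₁, hX₁, L.le_singL_iff.1 p.1.2 X hX⟩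
      · obtain ⟨Y, hY, -, hYX⟩ := L.le_eraseL_iff.1 p.2.2 X hX
        exact ⟨Y, hY, hYX⟩⟩
  let split (S : {S : L n d // S ≤ T}) : {S : L n d // S ≤ singL n d X₁ (T.mem.2 X₁ hX₁)}
      × {S : L n d // S ≤ eraseL n d T X₁} :=
    ⟨⟨⟨S.val.val.filter (fun Y => X₁ ⊆ Y), S.val.mem.mono (filter_subset _ _)⟩,
        L.le_singL_iff.2 fun X hX => (mem_filter.1 hX).2⟩,
      ⟨⟨S.val.val.filter (fun Y => ¬ X₁ ⊆ Y), S.val.mem.mono (filter_subset _ _)⟩,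
        L.le_eraseL_iff.2 fun X hX => by
          obtain ⟨hXS, hX₁X⟩ := mem_filter.1 hX
          obtain ⟨Y, hY, hYX⟩ := L.le_iff_forall_exists_subset.1 S.2 X hXS
          exact ⟨Y, hY, fun h => hX₁X (h ▸ hYX), hYX⟩⟩⟩
  have hext : ∀ {S S' : L n d}, S.val = S'.val → S = S' := by
    rintro ⟨S, _⟩ ⟨S', _⟩ rfl
    rfl
  refine ⟨⟨⟨union, split, ?_, ?_⟩, ?_⟩, fun p => rfl, fun S => ⟨rfl, rfl⟩⟩
  · rintro ⟨⟨S, hS⟩, ⟨S', hS'⟩⟩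
    have h := L.le_singL_iff.1 hS
    have h' := fun X => hns hS' (X := X)
    refine Prod.ext (Subtype.ext (hext ?_)) (Subtype.ext (hext ?_)) <;>
    · ext X
      simp only [union, split, mem_filter, mem_union]
      grind
  · rintro ⟨S, hS⟩
    exact Subtype.ext (hext (filter_union_filter_not_eq _ _))
  · rintro ⟨⟨S, hS⟩, ⟨S', hS'⟩⟩ ⟨⟨U, hU⟩, ⟨U', hU'⟩⟩
    change (union _).val ≤ (union _).val ↔ S ≤ U ∧ S' ≤ U'
    simp only [L.le_iff_forall_exists_subset, union, mem_union]
    constructor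
    · intro h
      constructor
      · intro X hX
        obtain ⟨Y, hY | hY, hYX⟩ := h X (Or.inl hX)
        · exact ⟨Y, hY, hYX⟩
        · obtain ⟨Z, hZ, hne, hZY⟩ := L.le_eraseL_iff.1 hU' Y hY
          exact absurd (T.mem.eq_of_subset hZ hX₁ (S.mem.2 X hX) (hZY.trans hYX)
            (L.le_singL_iff.1 hS X hX)) hne
      · intro X hX
        obtain ⟨Y, hY | hY, hYX⟩ := h X (Or.inr hX)
        · exact absurd ((L.le_singL_iff.1 hU Y hY).trans hYX) (hns hS' hX)
        · exact ⟨Y, hY, hYX⟩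
    · rintro ⟨h, h'⟩ X (hX | hX)
      · obtain ⟨Y, hY, hYX⟩ := h X hX
        exact ⟨Y, Or.inl hY, hYX⟩
      · obtain ⟨Y, hY, hYX⟩ := h' X hX
        exact ⟨Y, Or.inr hY, hYX⟩
end
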